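/- (Corollary 1.) Let Φzd : ℕ → Matrix (Fin p) (Fin m) ℝ and Φψd : ℕ → Matrix (Fin q) (Fin m) ℝ be kernels, θ ≥ 0, α ≥ 0, t_a ∈ ℕ, and take t_zd = t_ψd = 0. Let S be the set of signals d with |d(k)| ≤ α for all k ≤ t_a, d(k) = 0 for all k > t_a, and |(Φψd * d)(τ)| ≤ θ for all τ ≤ t_a. Then the supremum over d ∈ S of max_{0 ≤ n ≤ t_a} |(Φzd * d)(n)| equals the maximum over components j ∈ Fin p of the supremum over d ∈ S of the single linear objective ((Φzd * d)(t_a))_j; i.e., the worst-case attack is obtained by a single linear program maximizing ∑_{k=0}^{t_a} Φzd(t_a − k) d(k). -/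

import Mathlib

/-- Causal convolution of a kernel `Φ` with a signal `d`:
`(Φ * d)(n) = ∑_{k=0}^{n} Φ(n−k) · d(k)`. -/
noncomputable def conv {p m : ℕ} (Φ : ℕ → Matrix (Fin p) (Fin m) ℝ)
    (d : ℕ → Fin m → ℝ) (n : ℕ) : Fin p → ℝ :=
  ∑ k ∈ Finset.range (n + 1), (Φ (n - k)).mulVec (d k)

theorem conv_zero {p m : ℕ} (Φ : ℕ → Matrix (Fin p) (Fin m) ℝ) (n : ℕ) :
    conv Φ 0 n = 0 := by
  simp [conv]

theorem conv_neg {p m : ℕ} (Φ : ℕ → Matrix (Fin p) (Fin m) ℝ)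
    (d : ℕ → Fin m → ℝ) (n : ℕ) : conv Φ (-d) n = -conv Φ d n := by
  simp [conv, Matrix.mulVec_neg]

theorem exists_bound_norm_conv {p m : ℕ} (Φ : ℕ → Matrix (Fin p) (Fin m) ℝ)
    (α : ℝ) (t : ℕ) :
    ∃ B : ℝ, ∀ d : ℕ → Fin m → ℝ, (∀ k, k ≤ t → ‖d k‖ ≤ α) →
      ∀ n, n ≤ t → ‖conv Φ d n‖ ≤ B := by
  let c : ℕ → ℕ → ℝ := fun n k =>
    ‖LinearMap.toContinuousLinearMap (Matrix.toLin' (Φ (n - k)))‖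
  refine ⟨∑ n ∈ Finset.range (t + 1), ∑ k ∈ Finset.range (n + 1), c n k * |α|,
    fun d hd n hn => ?_⟩
  have hconv : ‖conv Φ d n‖ ≤ ∑ k ∈ Finset.range (n + 1), c n k * |α| := by
    refine norm_sum_le_of_le _ fun k hk => ?_
    have hdk : ‖d k‖ ≤ |α| :=
      (hd k (by rw [Finset.mem_range] at hk; omega)).trans (le_abs_self α)
    exact ((LinearMap.toContinuousLinearMap
      (Matrix.toLin' (Φ (n - k)))).le_opNorm (d k)).trans
        (mul_le_mul_of_nonneg_left hdk (norm_nonneg _))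
  refine hconv.trans (Finset.single_le_sum
    (f := fun n => ∑ k ∈ Finset.range (n + 1), c n k * |α|) (fun i _ => ?_)
    (Finset.mem_range.2 (Nat.lt_succ_of_le hn)))
  exact Finset.sum_nonneg fun k _ => mul_nonneg (norm_nonneg _) (abs_nonneg _)

/-- The signal `d` delayed by `s` and set to zero after time `t`. -/
def delay {m : ℕ} (s t : ℕ) (d : ℕ → Fin m → ℝ) (k : ℕ) : Fin m → ℝ :=
  if s ≤ k ∧ k ≤ t then d (k - s) else 0

theorem conv_delay_of_lt {p m : ℕ} (Φ : ℕ → Matrix (Fin p) (Fin m) ℝ)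
    (d : ℕ → Fin m → ℝ) {s t n : ℕ} (hn : n < s) : conv Φ (delay s t d) n = 0 := by
  refine Finset.sum_eq_zero fun k hk => ?_
  rw [Finset.mem_range] at hk
  rw [delay, if_neg (by omega), Matrix.mulVec_zero]

theorem conv_delay_add {p m : ℕ} (Φ : ℕ → Matrix (Fin p) (Fin m) ℝ)
    (d : ℕ → Fin m → ℝ) {s t n : ℕ} (hn : s + n ≤ t) :
    conv Φ (delay s t d) (s + n) = conv Φ d n := by
  rw [conv, add_assoc, Finset.sum_range_add, Finset.sum_eq_zero, zero_add, conv]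
  · refine Finset.sum_congr rfl fun k hk => ?_
    rw [Finset.mem_range] at hk
    rw [delay, if_pos (by omega), Nat.add_sub_add_left, Nat.add_sub_cancel_left]
  · intro k hk
    rw [Finset.mem_range] at hk
    rw [delay, if_neg (by omega), Matrix.mulVec_zero]

/-- Corollary 1 (`t_zd = t_ψd = 0`): the worst-case ℓ∞ impact over the window
`{0,…,t_a}` equals the maximum over components `j` of the supremum of the single
signed linear objective `((Φzd * d)(t_a))_j`; i.e., a single LP suffices. -/
theorem worst_attack_single_LP {p q m : ℕ}
    (Φzd : ℕ → Matrix (Fin p) (Fin m) ℝ)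
    (Φψd : ℕ → Matrix (Fin q) (Fin m) ℝ)
    (θ α : ℝ) (hθ : 0 ≤ θ) (hα : 0 ≤ α) (t_a : ℕ)
    (S : Set (ℕ → Fin m → ℝ))
    (hS : S = {d | (∀ k, k ≤ t_a → ‖d k‖ ≤ α) ∧ (∀ k, t_a < k → d k = 0) ∧
        (∀ τ, τ ≤ t_a → ‖conv Φψd d τ‖ ≤ θ)}) :
    sSup {x : ℝ | ∃ d ∈ S,
        x = (Finset.range (t_a + 1)).sup' (by simp)
              (fun n => ‖conv Φzd d n‖)} =
    ⨆ j : Fin p, sSup {x : ℝ | ∃ d ∈ S, x = conv Φzd d t_a j} := by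
  have hzero : (0 : ℕ → Fin m → ℝ) ∈ S := by
    rw [hS]
    exact ⟨fun k _ => by simpa using hα, fun k _ => rfl,
      fun τ _ => by simpa [conv_zero] using hθ⟩
  have hneg : ∀ d ∈ S, -d ∈ S := by
    rw [hS]
    rintro d ⟨h₁, h₂, h₃⟩
    exact ⟨fun k hk => by simpa using h₁ k hk, fun k hk => by simp [h₂ k hk],
      fun τ hτ => by simpa [conv_neg] using h₃ τ hτ⟩
  have hdelay : ∀ d ∈ S, ∀ s, delay s t_a d ∈ S := by
    rw [hS]
    rintro d ⟨h₁, h₂, h₃⟩ s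
    refine ⟨fun k hk => ?_, fun k hk => if_neg (by omega), fun τ hτ => ?_⟩
    · unfold delay
      split_ifs
      · exact h₁ _ (by omega)
      · simpa using hα
    · rcases lt_or_ge τ s with h | h
      · simpa [conv_delay_of_lt _ _ h] using hθ
      · obtain ⟨n, rfl⟩ := Nat.exists_eq_add_of_le h
        rw [conv_delay_add _ _ hτ]
        exact h₃ n (by omega)
  obtain ⟨B, hB⟩ : ∃ B : ℝ, ∀ d ∈ S, ∀ n, n ≤ t_a → ‖conv Φzd d n‖ ≤ B := by
    obtain ⟨B, hB⟩ := exists_bound_norm_conv Φzd α t_a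
    refine ⟨B, fun d hd => hB d ?_⟩
    rw [hS] at hd
    exact hd.1
  have hle : ∀ d ∈ S, ∀ j,
      conv Φzd d t_a j ≤ ⨆ j : Fin p, sSup {x : ℝ | ∃ d ∈ S, x = conv Φzd d t_a j} := by
    intro d hd j
    have hbdd : BddAbove {x : ℝ | ∃ d ∈ S, x = conv Φzd d t_a j} := by
      refine ⟨B, ?_⟩
      rintro _ ⟨e, he, rfl⟩
      exact ((le_abs_self _).trans (norm_le_pi_norm (conv Φzd e t_a) j)).trans
        (hB e he t_a le_rfl)
    exact (le_csSup hbdd ⟨d, hd, rfl⟩).trans (le_ciSup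
      (f := fun j : Fin p => sSup {x : ℝ | ∃ d ∈ S, x = conv Φzd d t_a j})
      (Set.finite_range _).bddAbove j)
  have hnonneg : 0 ≤ ⨆ j : Fin p, sSup {x : ℝ | ∃ d ∈ S, x = conv Φzd d t_a j} := by
    rcases isEmpty_or_nonempty (Fin p) with h | ⟨⟨j⟩⟩
    · rw [Real.iSup_of_isEmpty]
    · simpa [conv_zero] using hle 0 hzero j
  apply le_antisymm
  · refine csSup_le ⟨_, 0, hzero, rfl⟩ ?_
    rintro _ ⟨d, hd, rfl⟩
    refine Finset.sup'_le _ _ fun n hn => ?_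
    rw [Finset.mem_range] at hn
    obtain ⟨s, hs⟩ := Nat.exists_eq_add_of_le' (Nat.le_of_lt_succ hn)
    have hconv : conv Φzd (delay s t_a d) t_a = conv Φzd d n := by
      conv_lhs => rw [hs]
      exact conv_delay_add Φzd d le_rfl
    refine (pi_norm_le_iff_of_nonneg hnonneg).2 fun j => ?_
    rw [Real.norm_eq_abs, abs_le', ← hconv]
    refine ⟨hle _ (hdelay d hd s) j, ?_⟩
    simpa [conv_neg] using hle _ (hneg _ (hdelay d hd s)) j
  · have hbdd : BddAbove {x : ℝ | ∃ d ∈ S,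
        x = (Finset.range (t_a + 1)).sup' (by simp) (fun n => ‖conv Φzd d n‖)} := by
      refine ⟨B, ?_⟩
      rintro _ ⟨d, hd, rfl⟩
      exact Finset.sup'_le _ _ fun n hn =>
        hB d hd n (Nat.le_of_lt_succ (Finset.mem_range.1 hn))
    have hnorm : ∀ d ∈ S, ‖conv Φzd d t_a‖ ≤ sSup {x : ℝ | ∃ d ∈ S,
        x = (Finset.range (t_a + 1)).sup' (by simp) (fun n => ‖conv Φzd d n‖)} :=
      fun d hd => (Finset.le_sup' (fun n => ‖conv Φzd d n‖)
        (Finset.self_mem_range_succ t_a)).trans (le_csSup hbdd ⟨d, hd, rfl⟩)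
    have hnonneg' := (norm_nonneg _).trans (hnorm 0 hzero)
    refine Real.iSup_le (fun j => Real.sSup_le ?_ hnonneg') hnonneg'
    rintro _ ⟨d, hd, rfl⟩
    exact ((le_abs_self _).trans (norm_le_pi_norm (conv Φzd d t_a) j)).trans (hnorm d hd)
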